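/- arXiv:2410.00313 — 5 statements merged into one kernel-verified Lean document; each statement's English description precedes it below -/
import Mathlib

section
/- Let N ≥ 1 be an integer, let c1, c21, c22 be real numbers, and let m1, m2 ∈ {0,…,N−1} with m1 ≠ m2. Then the inner product of the two AFDM subcarriers built with the common post-chirp parameter c1 but possibly distinct pre-chirp parameters vanishes: ∑_{n=0}^{N−1} φ_n^{c1,c21}(m1) · conj(φ_n^{c1,c22}(m2)) = 0. In particular, applying distinct pre-chirp parameters to different subcarriers in the AFDM modulation process preserves their orthogonality (Theorem 1). -/
open Complex Finset

/-- The `m`-th AFDM chirp subcarrier (evaluated at time index `n`) with post-chirp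
parameter `c1` and pre-chirp parameter `c2`, for `N` subcarriers:
`φ_n^{c1,c2}(m) = (1/√N)·exp(2πi·(c1·n² + c2·m² + m·n/N))`. -/
noncomputable def afdmSubcarrier (N : ℕ) (c1 c2 : ℝ) (m n : ℕ) : ℂ :=
  (1 / Real.sqrt N : ℝ) *
    Complex.exp (2 * Real.pi * Complex.I *
      ((c1 * n ^ 2 + c2 * m ^ 2 + (m * n : ℝ) / N : ℝ) : ℂ))

/-- The powers of a nontrivial `N`-th root of unity `exp (2πi k / N)` sum to zero. -/
theorem sum_exp_two_pi_mul_I_div_pow_eq_zero {N : ℕ} (hN : N ≠ 0) {k : ℤ} (hk : ¬ (N : ℤ) ∣ k) :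
    ∑ n ∈ Finset.range N, Complex.exp (2 * Real.pi * Complex.I / N) ^ (k * n) = 0 := by
  have hζ := Complex.isPrimitiveRoot_exp N hN
  set ζ := Complex.exp (2 * Real.pi * Complex.I / N)
  have hne : ζ ^ k ≠ 1 := fun h => hk ((hζ.zpow_eq_one_iff_dvd k).1 h)
  have hpow : (ζ ^ k) ^ N = 1 := by
    rw [← zpow_natCast, ← zpow_mul, mul_comm, zpow_mul, zpow_natCast, hζ.pow_eq_one, one_zpow]
  simp_rw [zpow_mul, zpow_natCast]
  rw [geom_sum_eq hne, hpow, sub_self, zero_div]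

/-- The common post-chirp cancels in the product of a subcarrier with a conjugate subcarrier. -/
theorem afdmSubcarrier_mul_conj (N : ℕ) (c1 c21 c22 : ℝ) (m1 m2 n : ℕ) :
    afdmSubcarrier N c1 c21 m1 n * (starRingEnd ℂ) (afdmSubcarrier N c1 c22 m2 n) =
      ((1 / Real.sqrt N : ℝ) ^ 2 *
        Complex.exp (2 * Real.pi * Complex.I * (c21 * m1 ^ 2 - c22 * m2 ^ 2))) *
      Complex.exp (2 * Real.pi * Complex.I / N) ^ (((m1 : ℤ) - m2) * n) := by
  have hexp : Complex.exp (2 * Real.pi * Complex.I *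
        ((c1 * n ^ 2 + c21 * m1 ^ 2 + (m1 * n : ℝ) / N : ℝ) : ℂ)) *
      (starRingEnd ℂ) (Complex.exp (2 * Real.pi * Complex.I *
        ((c1 * n ^ 2 + c22 * m2 ^ 2 + (m2 * n : ℝ) / N : ℝ) : ℂ))) =
      Complex.exp (2 * Real.pi * Complex.I * (c21 * m1 ^ 2 - c22 * m2 ^ 2)) *
      Complex.exp (2 * Real.pi * Complex.I / N) ^ (((m1 : ℤ) - m2) * n) := by
    rw [← Complex.exp_conj, ← Complex.exp_int_mul, ← Complex.exp_add, ← Complex.exp_add]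
    congr 1
    simp only [map_mul, Complex.conj_ofReal, Complex.conj_I, map_ofNat]
    push_cast
    ring
  simp only [afdmSubcarrier, map_mul, Complex.conj_ofReal]
  rw [mul_mul_mul_comm, hexp]
  ring

/-- Theorem 1 (orthogonality): AFDM subcarriers with the same post-chirp parameter `c1`
but possibly distinct pre-chirp parameters `c21`, `c22` remain orthogonal: for
`m1 ≠ m2` in `{0,…,N−1}`, the inner product
`∑_{n=0}^{N−1} φ_n^{c1,c21}(m1) · conj(φ_n^{c1,c22}(m2))` vanishes. -/
theorem afdm_prechirp_orthogonality (N : ℕ) (hN : 1 ≤ N) (c1 c21 c22 : ℝ)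
    (m1 m2 : ℕ) (hm1 : m1 < N) (hm2 : m2 < N) (hne : m1 ≠ m2) :
    ∑ n ∈ Finset.range N,
      afdmSubcarrier N c1 c21 m1 n * (starRingEnd ℂ) (afdmSubcarrier N c1 c22 m2 n) = 0 := by
  have hdvd : ¬ (N : ℤ) ∣ (m1 : ℤ) - m2 := fun h => by
    have := Int.eq_zero_of_abs_lt_dvd h (by rw [abs_lt]; omega)
    omega
  simp_rw [afdmSubcarrier_mul_conj]
  rw [← Finset.mul_sum, sum_exp_two_pi_mul_I_div_pow_eq_zero (by omega) hdvd, mul_zero]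
end

section
/- Let N ≥ 1 be an integer, c1 ∈ ℝ, c2 : {0,…,N−1} → ℝ, let d be an integer with 0 ≤ d < N, and let α ∈ ℝ. Then for all m̄, m ∈ {0,…,N−1}, the (m̄, m) entry of the DAFT-domain effective channel matrix of a single path with delay d and normalized Doppler shift α satisfies (A·Γ_d·Δ_α·Π^d·Aᴴ)[m̄, m] = (1/N) · exp((2πi/N)·(N·c2(m)·m² − N·c2(m̄)·m̄² − m·d + N·c1·d²)) · ∑_{n=0}^{N−1} exp(−(2πi/N)·(m̄ − m + α + 2N·c1·d)·n). -/
open Complex Matrix Finset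

/-- The generalized DAFT matrix with post-chirp parameter `c1` and a per-subcarrier
pre-chirp assignment `c2 : Fin N → ℝ`:
`A[m,n] = (1/√N)·exp(−2πi·(c1·n² + c2(m)·m² + m·n/N))`. -/
noncomputable def daftMatrix (N : ℕ) (c1 : ℝ) (c2 : Fin N → ℝ) :
    Matrix (Fin N) (Fin N) ℂ :=
  fun m n => (1 / Real.sqrt N : ℝ) *
    Complex.exp (-(2 * Real.pi * Complex.I) *
      ((c1 * (n : ℕ) ^ 2 + c2 m * (m : ℕ) ^ 2 + ((m : ℕ) * (n : ℕ) : ℝ) / N : ℝ) : ℂ))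

/-- The forward cyclic-shift matrix: `Π[i,j] = 1` if `j ≡ i − 1 (mod N)`, else `0`. -/
def cyclicShift (N : ℕ) : Matrix (Fin N) (Fin N) ℂ :=
  fun i j => if ((j : ℕ) + 1) % N = (i : ℕ) then 1 else 0

/-- The Doppler diagonal matrix `Δ_α` with diagonal entries `exp(−2πi·α·n/N)`. -/
noncomputable def dopplerMatrix (N : ℕ) (α : ℝ) : Matrix (Fin N) (Fin N) ℂ :=
  Matrix.diagonal fun n =>
    Complex.exp (-(2 * Real.pi * Complex.I) * ((α * (n : ℕ) / N : ℝ) : ℂ))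

/-- The chirp-periodic-prefix diagonal matrix `Γ_d`: the `n`-th diagonal entry is
`exp(−2πi·c1·(N² − 2N(d − n)))` if `n < d`, and `1` otherwise. -/
noncomputable def cppMatrix (N : ℕ) (c1 : ℝ) (d : ℕ) : Matrix (Fin N) (Fin N) ℂ :=
  Matrix.diagonal fun n =>
    if (n : ℕ) < d then
      Complex.exp (-(2 * Real.pi * Complex.I) *
        ((c1 * ((N : ℝ) ^ 2 - 2 * N * ((d : ℝ) - (n : ℕ))) : ℝ) : ℂ))
    else 1

/-- The `d`-th power of the cyclic shift has entry `1` at `(i, j)` exactly when `i ≡ j + d`. -/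
theorem cyclicShift_pow_apply (N d : ℕ) (i j : Fin N) :
    (cyclicShift N ^ d) i j = if ((j : ℕ) + d) % N = (i : ℕ) then 1 else 0 := by
  induction d generalizing i j with
  | zero =>
    simp only [pow_zero, Matrix.one_apply, add_zero, Nat.mod_eq_of_lt j.isLt, Fin.ext_iff, eq_comm]
  | succ d ih =>
    have hlt : ((j : ℕ) + 1) % N < N := Nat.mod_lt _ j.pos
    rw [pow_succ, Matrix.mul_apply, Finset.sum_eq_single ⟨((j : ℕ) + 1) % N, hlt⟩]
    · simp only [ih, cyclicShift, if_true, mul_one, Nat.mod_add_mod]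
      rw [add_assoc, add_comm 1 d]
    · intro k _ hk
      have hne : ((j : ℕ) + 1) % N ≠ (k : ℕ) := fun h => hk (Fin.ext h.symm)
      simp [cyclicShift, hne]
    · simp

/-- Multiplication on the left by a power of the cyclic shift permutes the rows: row `n` of the
product is row `k`, where `k + d ≡ n`. -/
theorem cyclicShift_pow_mul_apply {N d : ℕ} (hd : d < N) (B : Matrix (Fin N) (Fin N) ℂ)
    {n k : Fin N} (hk : (k : ℕ) + d = n ∨ (k : ℕ) + d = n + N) (m : Fin N) :
    (cyclicShift N ^ d * B) n m = B k m := by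
  have hn := n.isLt
  rw [Matrix.mul_apply, Finset.sum_eq_single k]
  · have h : ((k : ℕ) + d) % N = n := by
      rcases hk with h | h <;> simp [h, Nat.mod_eq_of_lt hn]
    simp [cyclicShift_pow_apply, h]
  · intro l _ hl
    have hl' : (l : ℕ) ≠ k := fun h => hl (Fin.ext h)
    have hlN := l.isLt
    have h : ((l : ℕ) + d) % N ≠ n := by
      intro h
      rcases lt_or_ge ((l : ℕ) + d) N with h' | h'
      · rw [Nat.mod_eq_of_lt h'] at h
        omega
      · rw [Nat.mod_eq_sub_mod h', Nat.mod_eq_of_lt (by omega)] at h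
        omega
    simp [cyclicShift_pow_apply, h]
  · simp

/-- The entries of the conjugate transpose of the DAFT matrix. -/
theorem daftMatrix_conjTranspose_apply (N : ℕ) (c1 : ℝ) (c2 : Fin N → ℝ) (k m : Fin N) :
    (daftMatrix N c1 c2)ᴴ k m = (1 / Real.sqrt N : ℝ) *
      Complex.exp ((2 * Real.pi * Complex.I) *
        ((c1 * (k : ℕ) ^ 2 + c2 m * (m : ℕ) ^ 2 + ((m : ℕ) * (k : ℕ) : ℝ) / N : ℝ) : ℂ)) := by
  simp only [Matrix.conjTranspose_apply, daftMatrix, star_def, map_mul, conj_ofReal,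
    ← Complex.exp_conj, map_neg, conj_I, map_ofNat]
  congr 2
  ring

/-- The contribution of the time sample `n` to an entry of the effective channel matrix. -/
theorem daft_path_term {N : ℕ} (c1 : ℝ) (c2 : Fin N → ℝ) {d : ℕ} (hd : d < N) (α : ℝ)
    (mbar m n : Fin N) :
    daftMatrix N c1 c2 mbar n
        * (if (n : ℕ) < d then
            Complex.exp (-(2 * Real.pi * Complex.I) *
              ((c1 * ((N : ℝ) ^ 2 - 2 * N * ((d : ℝ) - (n : ℕ))) : ℝ) : ℂ))
          else 1)
        * Complex.exp (-(2 * Real.pi * Complex.I) * ((α * (n : ℕ) / N : ℝ) : ℂ))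
        * (cyclicShift N ^ d * (daftMatrix N c1 c2)ᴴ) n m
      = (1 / N : ℂ)
        * Complex.exp ((2 * Real.pi * Complex.I / N) *
            ((N * c2 m * (m : ℕ) ^ 2 - N * c2 mbar * (mbar : ℕ) ^ 2
              - (m : ℕ) * (d : ℝ) + N * c1 * (d : ℝ) ^ 2 : ℝ) : ℂ))
        * Complex.exp (-(2 * Real.pi * Complex.I / N) *
              ((((mbar : ℕ) : ℝ) - ((m : ℕ) : ℝ) + α + 2 * N * c1 * d) * (n : ℕ) : ℝ)) := by
  have hN : (N : ℂ) ≠ 0 := Nat.cast_ne_zero.mpr (by omega)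
  have hs : ((1 / Real.sqrt N : ℝ) : ℂ) * ((1 / Real.sqrt N : ℝ) : ℂ) = 1 / N := by
    rw [← ofReal_mul, div_mul_div_comm, Real.mul_self_sqrt (Nat.cast_nonneg N)]
    simp
  have hn := n.isLt
  rcases lt_or_ge (n : ℕ) d with h | h
  · rw [cyclicShift_pow_mul_apply hd _ (k := ⟨n + N - d, by omega⟩)
      (Or.inr (by simp only; omega)), daftMatrix_conjTranspose_apply, if_pos h, daftMatrix, ← hs]
    have key : ∀ s a b c e f g : ℂ, (∃ p : ℕ, a + b + c + e = f + g + p * (2 * Real.pi * I)) →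
        s * exp a * exp b * exp c * (s * exp e) = s * s * exp f * exp g := by
      rintro s a b c e f g ⟨p, hp⟩
      have : exp a * exp b * exp c * exp e = exp f * exp g := by
        simp only [← Complex.exp_add, hp]
        rw [Complex.exp_add, Complex.exp_nat_mul_two_pi_mul_I, mul_one]
      linear_combination s * s * this
    refine key _ _ _ _ _ _ _ ⟨m, ?_⟩
    simp only
    rw [Nat.cast_sub (by omega)]
    push_cast
    field_simp
    ring
  · rw [cyclicShift_pow_mul_apply hd _ (k := ⟨n - d, by omega⟩)
      (Or.inl (by simp only; omega)), daftMatrix_conjTranspose_apply, if_neg (by omega),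
      daftMatrix, ← hs]
    have key : ∀ s a c e f g : ℂ, a + c + e = f + g →
        s * exp a * 1 * exp c * (s * exp e) = s * s * exp f * exp g := by
      intro s a c e f g hp
      have : exp a * exp c * exp e = exp f * exp g := by
        simp only [← Complex.exp_add, hp]
      linear_combination s * s * this
    refine key _ _ _ _ _ _ ?_
    simp only
    rw [Nat.cast_sub h]
    push_cast
    field_simp
    ring

/-- Entry-wise formula for the DAFT-domain effective channel matrix of a single path
with integer delay `d` and real normalized Doppler shift `α`:
`(A·Γ_d·Δ_α·Π^d·Aᴴ)[mbar,m] = (1/N)·exp((2πi/N)·(N·c2(m)·m² − N·c2(mbar)·mbar² − m·d + N·c1·d²))`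
`· ∑_{n=0}^{N−1} exp(−(2πi/N)·(mbar − m + α + 2N·c1·d)·n)`. -/
theorem afdm_effective_channel_entry (N : ℕ) (hN : 1 ≤ N) (c1 : ℝ) (c2 : Fin N → ℝ)
    (d : ℕ) (hd : d < N) (α : ℝ) (mbar m : Fin N) :
    (daftMatrix N c1 c2 * cppMatrix N c1 d * dopplerMatrix N α *
        (cyclicShift N) ^ d * (daftMatrix N c1 c2)ᴴ) mbar m
      = (1 / N : ℂ)
        * Complex.exp ((2 * Real.pi * Complex.I / N) *
            ((N * c2 m * (m : ℕ) ^ 2 - N * c2 mbar * (mbar : ℕ) ^ 2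
              - (m : ℕ) * (d : ℝ) + N * c1 * (d : ℝ) ^ 2 : ℝ) : ℂ))
        * ∑ n ∈ Finset.range N,
            Complex.exp (-(2 * Real.pi * Complex.I / N) *
              ((((mbar : ℕ) : ℝ) - ((m : ℕ) : ℝ) + α + 2 * N * c1 * d) * n : ℝ)) := by
  rw [Matrix.mul_assoc, Matrix.mul_apply, Finset.mul_sum, Finset.sum_range]
  refine Finset.sum_congr rfl fun n _ => ?_
  rw [cppMatrix, dopplerMatrix, Matrix.mul_diagonal, Matrix.mul_diagonal]
  exact daft_path_term c1 c2 hd α mbar m n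
end

section
/- Let α_max ≥ 0, d_max ≥ 0 and N ≥ 1 be integers with (d_max + 1)·(2·α_max + 1) ≤ N. Then the map (d, α) ↦ ((2·α_max + 1)·d + α) mod N is injective on the grid {0,…,d_max} × {−α_max,…,α_max}. Consequently, under the parameter choice c1 = (2·α_max + 1)/(2N) and the condition (d_max + 1)·(2·α_max + 1) ≤ N, channel paths with distinct delay–Doppler pairs are distinguished within the DAFT domain (they occupy distinct cyclic diagonals of the N×N effective channel matrix). -/
/-- If `(d_max + 1)·(2·α_max + 1) ≤ N`, the map
`(d, α) ↦ ((2·α_max + 1)·d + α) mod N` is injective on the delay–Doppler grid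
`{0,…,d_max} × {−α_max,…,α_max}`. Hence, with `c1 = (2·α_max + 1)/(2N)` and this
condition, paths with distinct delay–Doppler pairs occupy distinct cyclic diagonals
of the `N×N` DAFT-domain effective channel matrix. -/
theorem afdm_loc_mod_injective (N : ℕ) (hN : 1 ≤ N) (αmax dmax : ℤ)
    (hα : 0 ≤ αmax) (hd : 0 ≤ dmax)
    (hcond : (dmax + 1) * (2 * αmax + 1) ≤ (N : ℤ)) :
    Set.InjOn (fun p : ℤ × ℤ => ((2 * αmax + 1) * p.1 + p.2) % (N : ℤ))
      (Set.Icc 0 dmax ×ˢ Set.Icc (-αmax) αmax) := by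
  rintro ⟨d, a⟩ ⟨⟨hd0, hd1⟩, ha0, ha1⟩ ⟨e, b⟩ ⟨⟨he0, he1⟩, hb0, hb1⟩ h
  dsimp only at hd0 hd1 ha0 ha1 he0 he1 hb0 hb1 h
  have hdvd : (N : ℤ) ∣ ((2 * αmax + 1) * d + a) - ((2 * αmax + 1) * e + b) :=
    Int.ModEq.dvd h.symm
  have hM : 0 ≤ 2 * αmax + 1 := by linarith
  have hde : (2 * αmax + 1) * (d - e) ≤ (2 * αmax + 1) * dmax :=
    mul_le_mul_of_nonneg_left (by linarith) hM
  have hed : (2 * αmax + 1) * (e - d) ≤ (2 * αmax + 1) * dmax :=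
    mul_le_mul_of_nonneg_left (by linarith) hM
  have hzero : ((2 * αmax + 1) * d + a) - ((2 * αmax + 1) * e + b) = 0 :=
    Int.eq_zero_of_abs_lt_dvd hdvd (abs_lt.mpr ⟨by linarith, by linarith⟩)
  have hab : b - a = 0 :=
    Int.eq_zero_of_abs_lt_dvd (m := 2 * αmax + 1) ⟨d - e, by linarith⟩
      (abs_lt.mpr ⟨by linarith, by linarith⟩)
  have hmul : (2 * αmax + 1) * (d - e) = 0 := by linarith
  have hsub : d - e = 0 := (mul_eq_zero.mp hmul).resolve_left (by linarith)
  exact Prod.ext (by linarith) (by linarith)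
end

section
/- Let N ≥ 1 and P ≥ 1 be integers, let loc : {1,…,P} → ℤ, and for each p let H_p and Ĥ_p be N×N complex matrices whose entries satisfy H_p[n, m] = 0 and Ĥ_p[n, m] = 0 whenever m ≢ n + loc_p (mod N) (i.e., each matrix is supported on the cyclic diagonal with shift loc_p). Suppose there exist indices a ≠ b with loc_a ≡ loc_b (mod N). Then for any vectors x, x̂ ∈ ℂ^N that are both supported on a single common coordinate k (x_i = 0 and x̂_i = 0 for all i ≠ k), the N×P matrix Φ whose p-th column is Ĥ_p·x̂ − H_p·x has rank at most P − 1. In particular, when two paths share the same DAFT-domain diagonal shift, the pairwise-difference matrix fails to attain full column rank P, so full diversity is lost. -/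
open Matrix

/-- A matrix over a field with a nonzero kernel vector does not have full column rank. -/
theorem Matrix.rank_lt_card_of_mulVec_eq_zero {m n K : Type*} [Fintype n] [Field K]
    {A : Matrix m n K} {v : n → K} (hv : v ≠ 0) (hAv : A *ᵥ v = 0) :
    A.rank < Fintype.card n := by
  have hker : 0 < Module.finrank K (LinearMap.ker A.mulVecLin) :=
    Module.finrank_pos_iff_exists_ne_zero.mpr
      ⟨⟨v, by simpa using hAv⟩, fun h => hv (congrArg Subtype.val h)⟩
  have hsum := A.mulVecLin.finrank_range_add_finrank_ker
  rw [Module.finrank_fintype_fun_eq_card] at hsum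
  unfold Matrix.rank
  omega

/-- A matrix with two distinct columns that vanish off one common row does not have full
column rank. -/
theorem Matrix.rank_lt_card_of_cols_supported_on_row {m n K : Type*} [Fintype n]
    [Field K] {A : Matrix m n K} {a b : n} (hab : a ≠ b) {r : m}
    (ha : ∀ i, i ≠ r → A i a = 0) (hb : ∀ i, i ≠ r → A i b = 0) :
    A.rank < Fintype.card n := by
  classical
  by_cases h : A r a = 0
  · refine Matrix.rank_lt_card_of_mulVec_eq_zero (v := Pi.single a 1) (by simp) ?_
    ext i
    by_cases hi : i = r
    · simp [hi, h]
    · simp [ha i hi]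
  · refine Matrix.rank_lt_card_of_mulVec_eq_zero
      (v := Pi.single a (A r b) - Pi.single b (A r a)) (fun hv => h ?_) ?_
    · simpa [hab.symm] using congrFun hv b
    · ext i
      by_cases hi : i = r
      · simp [Matrix.mulVec_sub, hi, mul_comm]
      · simp [Matrix.mulVec_sub, ha i hi, hb i hi]

/-- A vector supported on the coordinate `k` is mapped to the multiple `x k` of column `k`. -/
theorem Matrix.mulVec_apply_of_supported_on {m n R : Type*} [Fintype n]
    [NonUnitalNonAssocSemiring R] (A : Matrix m n R) {x : n → R} {k : n}
    (hx : ∀ i, i ≠ k → x i = 0) (i : m) : (A *ᵥ x) i = A i k * x k :=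
  Fintype.sum_eq_single k fun j hj => by simp [hx j hj]

/-- Every cyclic diagonal meets column `k` in only one row. -/
theorem Fin.exists_forall_ne_cyclic_shift {N : ℕ} (k : Fin N) (s : ℤ) :
    ∃ r : Fin N, ∀ n : Fin N, n ≠ r →
      ((k : ℕ) : ℤ) % (N : ℤ) ≠ (((n : ℕ) : ℤ) + s) % (N : ℤ) := by
  have hN : (0 : ℤ) < N := by exact_mod_cast k.pos
  have hlo := Int.emod_nonneg (((k : ℕ) : ℤ) - s) hN.ne'
  have hhi := Int.emod_lt_of_pos (((k : ℕ) : ℤ) - s) hN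
  refine ⟨⟨((((k : ℕ) : ℤ) - s) % N).toNat, by omega⟩, fun n hn h => hn (Fin.ext ?_)⟩
  have hmod : ((k : ℕ) : ℤ) - s ≡ n [ZMOD N] := by
    simpa using Int.ModEq.sub_right s (show ((k : ℕ) : ℤ) ≡ n + s [ZMOD N] from h)
  have hn' : ((n : ℕ) : ℤ) % N = n := Int.emod_eq_of_lt (by omega) (by omega)
  have heq : (((k : ℕ) : ℤ) - s) % N = n := Eq.trans hmod hn'
  simp [heq]

/-- If two paths `a ≠ b` share the same cyclic-diagonal shift modulo `N`
(`loc_a ≡ loc_b (mod N)`), and each per-path matrix `H_p`, `Ĥ_p` is supported on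
the cyclic diagonal with shift `loc_p`, then for transmit vectors `x`, `x̂` both
supported on a single common coordinate `k`, the `N×P` pairwise-difference matrix
`Φ` with columns `Ĥ_p·x̂ − H_p·x` has rank at most `P − 1`: full column rank
(full diversity) is lost. -/
theorem afdm_rank_deficient_of_shared_diagonal (N P : ℕ) (hN : 1 ≤ N) (hP : 1 ≤ P)
    (loc : Fin P → ℤ)
    (H Hhat : Fin P → Matrix (Fin N) (Fin N) ℂ)
    (hH : ∀ (p : Fin P) (n m : Fin N),
      ((m : ℕ) : ℤ) % (N : ℤ) ≠ (((n : ℕ) : ℤ) + loc p) % (N : ℤ) → H p n m = 0)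
    (hHhat : ∀ (p : Fin P) (n m : Fin N),
      ((m : ℕ) : ℤ) % (N : ℤ) ≠ (((n : ℕ) : ℤ) + loc p) % (N : ℤ) → Hhat p n m = 0)
    (a b : Fin P) (hab : a ≠ b) (hloc : loc a % (N : ℤ) = loc b % (N : ℤ))
    (x xhat : Fin N → ℂ) (k : Fin N)
    (hx : ∀ i : Fin N, i ≠ k → x i = 0) (hxhat : ∀ i : Fin N, i ≠ k → xhat i = 0) :
    Matrix.rank (Matrix.of fun (n : Fin N) (p : Fin P) =>
        (Hhat p).mulVec xhat n - (H p).mulVec x n) ≤ P - 1 := by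
  obtain ⟨r, hr⟩ := Fin.exists_forall_ne_cyclic_shift k (loc a)
  have hcol : ∀ p, loc a % (N : ℤ) = loc p % (N : ℤ) → ∀ n, n ≠ r →
      (Hhat p).mulVec xhat n - (H p).mulVec x n = 0 := by
    intro p hp n hn
    have hoff : ((k : ℕ) : ℤ) % (N : ℤ) ≠ (((n : ℕ) : ℤ) + loc p) % (N : ℤ) := by
      rw [Int.add_emod, ← hp, ← Int.add_emod]
      exact hr n hn
    simp [Matrix.mulVec_apply_of_supported_on _ hx, Matrix.mulVec_apply_of_supported_on _ hxhat,
      hH p n k hoff, hHhat p n k hoff]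
  have hlt := Matrix.rank_lt_card_of_cols_supported_on_row
    (A := Matrix.of fun (n : Fin N) (p : Fin P) => (Hhat p).mulVec xhat n - (H p).mulVec x n)
    hab (hcol a rfl) (hcol b hloc)
  rw [Fintype.card_fin] at hlt
  exact Nat.le_sub_one_of_lt hlt
end

section
/- Let N_c ≥ 2, a and M be integers with 1 ≤ a < N_c and M ≥ 2. Then (⌊log₂(N_c!)⌋)/N_c + log₂(M) > (⌊log₂(C(N_c, a))⌋ + a·log₂(M))/N_c, where C(N_c, a) is the binomial coefficient, log₂ denotes the real base-2 logarithm, and ⌊log₂(n)⌋ for a positive integer n denotes the floor of its base-2 logarithm. That is, the spectral efficiency of AFDM-PIM strictly exceeds that of AFDM-IM at the same group size and constellation order. -/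
/-- The spectral efficiency of AFDM-PIM strictly exceeds that of AFDM-IM at the same
group size `N_c` and constellation order `M`: for `N_c ≥ 2`, `1 ≤ a < N_c`, `M ≥ 2`,
`⌊log₂(N_c!)⌋/N_c + log₂(M) > (⌊log₂ C(N_c, a)⌋ + a·log₂(M))/N_c`,
where `⌊log₂ n⌋` of a positive integer `n` is `Nat.log 2 n`. -/
theorem afdm_pim_se_exceeds_afdm_im (Nc a M : ℕ) (hNc : 2 ≤ Nc)
    (ha1 : 1 ≤ a) (ha2 : a < Nc) (hM : 2 ≤ M) :
    (Nat.log 2 (Nat.factorial Nc) : ℝ) / Nc + Real.logb 2 M >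
      ((Nat.log 2 (Nc.choose a) : ℝ) + a * Real.logb 2 M) / Nc := by
  have hchoose : Nc.choose a ≤ Nat.factorial Nc :=
    Nat.le_of_dvd (Nat.factorial_pos Nc)
      ⟨Nat.factorial a * Nat.factorial (Nc - a), by
        rw [← mul_assoc, Nat.choose_mul_factorial_mul_factorial ha2.le]⟩
  have hlog : (Nat.log 2 (Nc.choose a) : ℝ) ≤ Nat.log 2 (Nat.factorial Nc) := by
    exact_mod_cast Nat.log_mono_right hchoose
  have hM_pos : 0 < Real.logb 2 M :=
    Real.logb_pos one_lt_two (by exact_mod_cast hM)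
  have hNc_pos : (0 : ℝ) < Nc := by positivity
  have hmul : (a : ℝ) * Real.logb 2 M < Nc * Real.logb 2 M :=
    mul_lt_mul_of_pos_right (by exact_mod_cast ha2) hM_pos
  rw [gt_iff_lt, div_add' _ _ _ hNc_pos.ne', div_lt_div_iff_of_pos_right hNc_pos]
  linarith
end
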